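/- Let X be a metric space and H : ℕ → Set X a sequence of subsets such that each H n is nonempty and compact, H (n+1) ⊆ H n, and every connected component of H n contains at least two components of H (n+1) (in particular at least one). Then for every n and every point x ∈ H n, the connected component of x in H n contains a point of the intersection K = ⋂ m, H m. -/

import Mathlib

open Metric

theorem IsClosed.isClosed_connectedComponentIn {X : Type*} [TopologicalSpace X] {F : Set X}
    (hF : IsClosed F) (x : X) : IsClosed (connectedComponentIn F x) := by
  by_cases hx : x ∈ F
  · refine isClosed_of_closure_subset ?_
    exact isPreconnected_connectedComponentIn.closure.subset_connectedComponentIn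
      (subset_closure (mem_connectedComponentIn hx))
      (closure_minimal (connectedComponentIn_subset F x) hF)
  · rw [connectedComponentIn_eq_empty hx]
    exact isClosed_empty

/-- If every component of each term of a nested sequence meets the next term, then it meets all
later terms. -/
theorem connectedComponentIn_inter_nonempty {X : Type*} [TopologicalSpace X] {H : ℕ → Set X}
    (hnested : ∀ n, H (n + 1) ⊆ H n)
    (hmeet : ∀ n, ∀ x ∈ H n, (connectedComponentIn (H n) x ∩ H (n + 1)).Nonempty)
    (k n : ℕ) {x : X} (hx : x ∈ H n) :
    (connectedComponentIn (H n) x ∩ H (n + k)).Nonempty := by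
  induction k generalizing n x with
  | zero => exact ⟨x, mem_connectedComponentIn hx, hx⟩
  | succ k ih =>
    obtain ⟨y, hyx, hy⟩ := hmeet n x hx
    obtain ⟨z, hzy, hz⟩ := ih (n + 1) hy
    refine ⟨z, ?_, ?_⟩
    · rw [connectedComponentIn_eq hyx]
      exact connectedComponentIn_mono y (hnested n) hzy
    · rwa [Nat.add_right_comm, Nat.add_assoc] at hz

/-- If `H` is a nested sequence of nonempty compact sets such that every connected
component of `H n` contains at least two components of `H (n+1)` (in particular at
least one), then every connected component of every `H n` meets the intersection
`⋂ m, H m`. -/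
theorem component_meets_intersection
    {X : Type*} [MetricSpace X] (H : ℕ → Set X)
    (hne : ∀ n, (H n).Nonempty)
    (hcpt : ∀ n, IsCompact (H n))
    (hnested : ∀ n, H (n + 1) ⊆ H n)
    (htwo : ∀ n, ∀ x ∈ H n, ∃ y ∈ H (n + 1), ∃ z ∈ H (n + 1),
      y ∈ connectedComponentIn (H n) x ∧ z ∈ connectedComponentIn (H n) x ∧
      connectedComponentIn (H (n + 1)) y ≠ connectedComponentIn (H (n + 1)) z) :
    ∀ n, ∀ x ∈ H n, ∃ y ∈ ⋂ m, H m, y ∈ connectedComponentIn (H n) x := by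
  intro n x hx
  have hanti : Antitone H := antitone_nat_of_succ_le hnested
  have hmeet : ∀ n, ∀ x ∈ H n, (connectedComponentIn (H n) x ∩ H (n + 1)).Nonempty := by
    intro n x hx
    obtain ⟨y, hy, _, _, hyx, _⟩ := htwo n x hx
    exact ⟨y, hyx, hy⟩
  have hclosed := (hcpt n).isClosed.isClosed_connectedComponentIn x
  obtain ⟨y, hy⟩ := IsCompact.nonempty_iInter_of_sequence_nonempty_isCompact_isClosed
    (fun k => connectedComponentIn (H n) x ∩ H (n + k))
    (fun k => Set.inter_subset_inter_right _ (hnested (n + k)))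
    (fun k => connectedComponentIn_inter_nonempty hnested hmeet k n hx)
    ((hcpt _).inter_left hclosed)
    (fun k => hclosed.inter (hcpt _).isClosed)
  rw [Set.mem_iInter] at hy
  exact ⟨y, Set.mem_iInter.2 fun m => hanti (Nat.le_add_left m n) (hy m).2, (hy 0).1⟩
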